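/- Let T be a forest, let v be a stem of T that has a non-leaf neighbor, let R be the set of leaf neighbors of v, and let r = |R| ≥ 1. Then χ_ISC(T) ≤ χ_ISC(T − R) + r + u_r. -/

import Mathlib

variable {V : Type} [Fintype V] [DecidableEq V]

/-- The `k`-th triangular number `t_k = C(k+1,2)`. -/
def tri (k : ℕ) : ℕ := (k + 1).choose 2

/-- A natural number is triangular if it equals `t_k` for some `k`. -/
def IsTriangular (m : ℕ) : Prop := ∃ k, m = tri k

/-- `uval r = max {k : t_k ≤ r}`. -/
def uval (r : ℕ) : ℕ := Nat.findGreatest (fun k => tri k ≤ r) r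

/-- The lists `L` admit a proper coloring of the subgraph of `G` induced by `S`,
with each vertex of `S` colored from its list. -/
def ColorableOn (G : SimpleGraph V) (S : Finset V) (L : V → Finset ℕ) : Prop :=
  ∃ φ : V → ℕ, (∀ v ∈ S, φ v ∈ L v) ∧ ∀ x ∈ S, ∀ y ∈ S, G.Adj x y → φ x ≠ φ y

/-- In the interactive sum choice game on the subgraph of `G` induced by `S`, starting
from lists `L`, Requester can force the game to end within `n` further rounds: either the
current lists already admit a proper coloring, or Requester can request a new color at
some vertex `v ∈ S` so that, whatever color `c ∉ L v` Supplier adds to `L v`, Requester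
can finish within `n - 1` further rounds. -/
def ReqWins (G : SimpleGraph V) (S : Finset V) : (V → Finset ℕ) → ℕ → Prop
  | L, 0 => ColorableOn G S L
  | L, n + 1 => ColorableOn G S L ∨
      ∃ v ∈ S, ∀ c ∉ L v, ReqWins G S (Function.update L v (insert c (L v))) n

/-- The interactive sum choice number of the subgraph of `G` induced by `S`:
the optimal number of rounds of the interactive sum choice game, namely the least `n`
such that Requester can force the game, started from empty lists, to end within `n`
rounds. -/
noncomputable def isc (G : SimpleGraph V) (S : Finset V) : ℕ :=
  sInf {n | ReqWins G S (fun _ => ∅) n}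

/-- A vertex is a leaf if it has exactly one neighbor. -/
def IsLeaf (G : SimpleGraph V) (v : V) : Prop := (G.neighborSet v).ncard = 1

/-- A stem in a forest: a vertex with at least one leaf neighbor and at most one
non-leaf neighbor. -/
def IsStem (G : SimpleGraph V) (v : V) : Prop :=
  (∃ w, G.Adj v w ∧ IsLeaf G w) ∧ {w | G.Adj v w ∧ ¬ IsLeaf G w}.ncard ≤ 1

theorem tri_succ (b : ℕ) : tri (b + 1) = tri b + (b + 1) := by
  unfold tri
  rw [Nat.choose_succ_succ' (b + 1) 1, Nat.choose_one_right, Nat.add_comm]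

theorem le_tri (b : ℕ) : b ≤ tri b := by
  induction b with
  | zero => exact Nat.zero_le _
  | succ b ih => rw [tri_succ]; omega

theorem lt_tri_uval_succ (r : ℕ) : r < tri (uval r + 1) := by
  by_cases h : uval r + 1 ≤ r
  · exact not_le.mp (Nat.findGreatest_is_greatest (P := fun k => tri k ≤ r)
      (Nat.lt_succ_self _) h)
  · exact (not_le.mp h).trans_le (le_tri _)

section Lists

variable {W : Type} {R : Finset W} {v : W} {L L' : W → Finset ℕ}

/-- The vertices of `R` whose list consists of the single color `c`. -/
def monoLists (R : Finset W) (L : W → Finset ℕ) (c : ℕ) : Finset W :=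
  R.filter fun y => L y = {c}

/-- The vertices of `R` whose list shares no color with that of `v`. -/
def unmetLists (R : Finset W) (v : W) (L : W → Finset ℕ) : Finset W :=
  R.filter fun y => Disjoint (L y) (L v)

theorem monoLists_congr (h : ∀ y ∈ R, L y = L' y) (c : ℕ) :
    monoLists R L c = monoLists R L' c :=
  Finset.filter_congr fun y hy => by rw [h y hy]

theorem unmetLists_congr (h : ∀ y ∈ R, L y = L' y) (hv : L v = L' v) :
    unmetLists R v L = unmetLists R v L' :=
  Finset.filter_congr fun y hy => by rw [h y hy, hv]

variable [DecidableEq W] {G : SimpleGraph W} {S : Finset W}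

theorem update_apply_of_mem {x y : W} (hx : x ∉ R) (hy : y ∈ R) (L : W → Finset ℕ)
    (s : Finset ℕ) : Function.update L x s y = L y :=
  Function.update_of_ne (fun h : y = x => hx (h ▸ hy)) _ _

theorem card_monoLists_add_card_unmetLists_le (hv : v ∉ R) {c : ℕ} (hc : c ∉ L v) :
    (monoLists R L c).card +
      (unmetLists R v (Function.update L v (insert c (L v)))).card ≤
        (unmetLists R v L).card := by
  have hne : ∀ y ∈ R, y ≠ v := fun y hy h => hv (h ▸ hy)
  rw [← Finset.card_union_of_disjoint]
  · refine Finset.card_le_card fun y hy => ?_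
    simp only [monoLists, unmetLists, Finset.mem_union, Finset.mem_filter] at hy ⊢
    rcases hy with ⟨hyR, hy⟩ | ⟨hyR, hy⟩
    · exact ⟨hyR, by simpa [hy] using hc⟩
    · rw [Function.update_of_ne (hne y hyR), Function.update_self,
        Finset.disjoint_insert_right] at hy
      exact ⟨hyR, hy.2⟩
  · refine Finset.disjoint_left.mpr fun y hy hy' => ?_
    simp only [monoLists, unmetLists, Finset.mem_filter] at hy hy'
    rw [Function.update_of_ne (hne y hy.1), Function.update_self, hy.2] at hy'
    simp at hy'

theorem ColorableOn.reqWins (h : ColorableOn G S L) (n : ℕ) : ReqWins G S L n := by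
  cases n with
  | zero => exact h
  | succ n => exact Or.inl h

theorem ReqWins.succ {n : ℕ} (h : ReqWins G S L n) : ReqWins G S L (n + 1) := by
  induction n generalizing L with
  | zero => exact Or.inl h
  | succ n ih =>
    rcases h with h | ⟨x, hx, h⟩
    · exact Or.inl h
    · exact Or.inr ⟨x, hx, fun c hc => ih (h c hc)⟩

theorem ReqWins.mono {m n : ℕ} (h : ReqWins G S L m) (hmn : m ≤ n) : ReqWins G S L n := by
  induction n, hmn using Nat.le_induction with
  | base => exact h
  | succ n _ ih => exact ih.succ

end Lists

section Game

variable {G : SimpleGraph V} {S R : Finset V} {v w : V} {L L' : V → Finset ℕ}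

theorem colorableOn_of_card_le (h : ∀ x ∈ S, Fintype.card V ≤ (L x).card) :
    ColorableOn G S L := by
  obtain ⟨f, hf, hfL⟩ := (Finset.all_card_le_biUnion_card_iff_exists_injective
    (fun x : S => L x)).mp (fun s => by
      rcases s.eq_empty_or_nonempty with rfl | ⟨x, hx⟩
      · simp
      · calc s.card ≤ Fintype.card S := s.card_le_univ
          _ ≤ Fintype.card V := Fintype.card_le_of_injective _ Subtype.val_injective
          _ ≤ (L x).card := h x x.2
          _ ≤ _ := Finset.card_le_card (Finset.subset_biUnion_of_mem (fun x : S => L x) hx))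
  refine ⟨fun x => if hx : x ∈ S then f ⟨x, hx⟩ else 0, fun x hx => ?_, fun x hx y hy hxy h => ?_⟩
  · simpa [hx] using hfL ⟨x, hx⟩
  · simp only [hx, hy, dite_true] at h
    exact hxy.ne (congrArg Subtype.val (hf h))

theorem exists_reqWins (G : SimpleGraph V) (S : Finset V) (L : V → Finset ℕ) :
    ∃ n, ReqWins G S L n := by
  suffices ∀ n L, ∑ x ∈ S, (Fintype.card V - (L x).card) ≤ n → ReqWins G S L n from
    ⟨_, this _ L le_rfl⟩
  intro n
  induction n with
  | zero =>
    intro L h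
    refine colorableOn_of_card_le fun x hx => ?_
    have := Finset.sum_eq_zero_iff.mp (Nat.le_zero.mp h) x hx
    omega
  | succ n ih =>
    intro L h
    by_cases hS : ∀ x ∈ S, Fintype.card V ≤ (L x).card
    · exact Or.inl (colorableOn_of_card_le hS)
    push Not at hS
    obtain ⟨x, hx, hlt⟩ := hS
    refine Or.inr ⟨x, hx, fun c hc => ih _ (Nat.le_of_lt_succ (lt_of_lt_of_le ?_ h))⟩
    refine Finset.sum_lt_sum (fun y _ => ?_) ⟨x, hx, ?_⟩
    · by_cases hyx : y = x
      · subst hyx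
        simp only [Function.update_self, Finset.card_insert_of_notMem hc]
        omega
      · simp [hyx]
    · simp only [Function.update_self, Finset.card_insert_of_notMem hc]
      omega

/-- A pendant set whose lists are nonempty can be colored after one further request
at each list consisting only of the color of `v`. -/
theorem reqWins_of_card_monoLists_le (hv : v ∉ R) (hRv : ∀ y ∈ R, ∀ z, G.Adj y z → z = v)
    {φ : V → ℕ} {n : ℕ} (hne : ∀ y ∈ R, (L y).Nonempty)
    (hφL : ∀ x ∈ Finset.univ \ R, φ x ∈ L x)
    (hφ : ∀ x ∈ Finset.univ \ R, ∀ y ∈ Finset.univ \ R, G.Adj x y → φ x ≠ φ y)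
    (hn : (monoLists R L (φ v)).card ≤ n) : ReqWins G Finset.univ L n := by
  induction n generalizing L with
  | zero =>
    have hmono : ∀ y ∈ R, ∃ a ∈ L y, a ≠ φ v := fun y hy => by
      have hy' : L y ≠ {φ v} := fun h => by
        have : y ∈ monoLists R L (φ v) := Finset.mem_filter.mpr ⟨hy, h⟩
        rw [Finset.card_eq_zero.mp (Nat.le_zero.mp hn)] at this
        simp at this
      by_contra! h
      exact hy' ((hne y hy).subset_singleton_iff.mp fun a ha => by simp [h a ha])
    choose! ψ hψL hψ using hmono
    refine ⟨fun x => if x ∈ R then ψ x else φ x, fun x _ => ?_, fun x _ y _ hxy => ?_⟩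
    · by_cases hx : x ∈ R
      · simpa [hx] using hψL x hx
      · simpa [hx] using hφL x (by simp [hx])
    · by_cases hx : x ∈ R
      · obtain rfl := hRv x hx y hxy
        simpa [hx, hv] using hψ x hx
      · by_cases hy : y ∈ R
        · obtain rfl := hRv y hy x hxy.symm
          simpa [hy, hv] using (hψ y hy).symm
        · simpa [hx, hy] using hφ x (by simp [hx]) y (by simp [hy]) hxy
  | succ n ih =>
    rcases (monoLists R L (φ v)).eq_empty_or_nonempty with h0 | ⟨y, hy⟩
    · exact (ih hne hφL (by simp [h0])).succ
    · have hyR : y ∈ R := (Finset.mem_filter.mp hy).1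
      have hLy : L y = {φ v} := (Finset.mem_filter.mp hy).2
      refine Or.inr ⟨y, Finset.mem_univ _, fun c hc => ih (fun z hz => ?_) (fun x hx => ?_) ?_⟩
      · by_cases hzy : z = y
        · subst hzy; simp
        · simpa [hzy] using hne z hz
      · have hxy : x ≠ y := fun h => (Finset.mem_sdiff.mp hx).2 (h ▸ hyR)
        simpa [hxy] using hφL x hx
      · refine Nat.le_of_lt_succ (lt_of_lt_of_le (Finset.card_lt_card ?_) hn)
        refine (Finset.ssubset_iff_of_subset fun z hz => ?_).mpr ⟨y, hy, fun h => ?_⟩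
        · obtain ⟨hzR, hz⟩ := Finset.mem_filter.mp hz
          refine Finset.mem_filter.mpr ⟨hzR, ?_⟩
          by_cases hzy : z = y
          · rw [hzy, hLy]
          · simpa [hzy] using hz
        · have h := (Finset.mem_filter.mp h).2
          rw [Function.update_self] at h
          have : c = φ v := by simpa using h.subset (Finset.mem_insert_self c _)
          exact hc (by simp [hLy, this])

/-- Requester repeatedly asks for a color at `v` until the number of singleton lists
blocked by the new color fits in the remaining budget. -/
theorem reqWins_of_card_unmetLists_lt (hv : v ∉ R) {k b : ℕ}
    (hN : (unmetLists R v L).card < tri (b + 1))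
    (h : ∀ s : Finset ℕ, ∀ c ∈ s \ L v, ∀ b', L v ⊆ s →
      (monoLists R L c).card ≤ b' →
      (unmetLists R v (Function.update L v s)).card < tri (b' + 1) →
      ReqWins G Finset.univ (Function.update L v s) (k + b')) :
    ReqWins G Finset.univ L (k + 1 + b) := by
  induction b generalizing L with
  | zero =>
    refine Or.inr ⟨v, Finset.mem_univ _, fun c hc => ?_⟩
    have := card_monoLists_add_card_unmetLists_le hv hc
    have ht : tri (0 + 1) = 1 := rfl
    exact h _ c (by simp [hc]) 0 (Finset.subset_insert _ _) (by omega) (by omega)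
  | succ b ih =>
    rw [← Nat.add_assoc]
    refine Or.inr ⟨v, Finset.mem_univ _, fun c hc => ?_⟩
    have hle := card_monoLists_add_card_unmetLists_le hv hc
    by_cases hm : (monoLists R L c).card ≤ b + 1
    · exact (h _ c (by simp [hc]) (b + 1) (Finset.subset_insert _ _) hm (by omega)).mono
        (by omega)
    · have ht := tri_succ (b + 1)
      refine ih (by omega) fun s d hd b' hs hmd hNd => ?_
      rw [Function.update_self] at hd hs
      rw [Function.update_idem] at hNd ⊢
      have hcongr : monoLists R (Function.update L v (insert c (L v))) d = monoLists R L d :=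
        monoLists_congr (fun y hy => update_apply_of_mem hv hy L _) d
      rw [hcongr] at hmd
      rw [Finset.mem_sdiff, Finset.mem_insert, not_or] at hd
      exact h s d (Finset.mem_sdiff.mpr ⟨hd.1, hd.2.2⟩) b'
        ((Finset.subset_insert _ _).trans hs) hmd hNd

/-- Requester follows a strategy for the graph without the pendant set `R`. Once that
strategy has spent a surplus request on `v`, one color at `v` fitting in the budget
suffices, whatever color the strategy gives to the other neighbor `w`. -/
theorem ReqWins.univ_of_surplus (hv : v ∉ R) (hRv : ∀ y ∈ R, ∀ z, G.Adj y z → z = v)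
    (hw : ∀ z, z ∉ R → G.Adj v z → z = w) {n b c : ℕ}
    (hS : ReqWins G (Finset.univ \ R) L' n) (hL : ∀ x ∉ R, x ≠ v → L x = L' x)
    (hne : ∀ y ∈ R, (L y).Nonempty) (hc : c ∈ L v)
    (hm : (monoLists R L c).card ≤ b) (hN : (unmetLists R v L).card < tri (b + 1)) :
    ReqWins G Finset.univ L (n + (b + 1)) := by
  have colorable : ∀ {L L' : V → Finset ℕ}, ColorableOn G (Finset.univ \ R) L' →
      (∀ x ∉ R, x ≠ v → L x = L' x) → (∀ y ∈ R, (L y).Nonempty) → c ∈ L v →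
      (monoLists R L c).card ≤ b → (unmetLists R v L).card < tri (b + 1) →
      ReqWins G Finset.univ L (b + 1) := by
    rintro L L' ⟨φ, hφL, hφ⟩ hL hne hc hm hN
    have finish : ∀ {s : Finset ℕ} {d b' : ℕ}, d ∈ s → (G.Adj v w → d ≠ φ w) →
        (monoLists R L d).card ≤ b' →
        ReqWins G Finset.univ (Function.update L v s) b' := by
      intro s d b' hd hdw hmd
      refine reqWins_of_card_monoLists_le (φ := Function.update φ v d) hv hRv
        (fun y hy => ?_) (fun x hx => ?_) (fun x hx y hy hxy => ?_) ?_
      · rw [update_apply_of_mem hv hy]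
        exact hne y hy
      · by_cases hxv : x = v
        · subst hxv; simpa using hd
        · have hxR : x ∉ R := by simpa using hx
          simpa [hxv, hL x hxR hxv] using hφL x hx
      · have hxR : x ∉ R := by simpa using hx
        have hyR : y ∉ R := by simpa using hy
        by_cases hxv : x = v
        · subst hxv
          obtain rfl := hw y hyR hxy
          simpa [hxy.ne'] using hdw hxy
        · by_cases hyv : y = v
          · subst hyv
            obtain rfl := hw x hxR hxy.symm
            simpa [hxv] using (hdw hxy.symm).symm
          · simpa [hxv, hyv] using hφ x hx y hy hxy
      · rw [Function.update_self, monoLists_congr (L' := L)]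
        · exact hmd
        · exact fun y hy => update_apply_of_mem hv hy L _
    by_cases hcw : c = φ w
    · have := reqWins_of_card_unmetLists_lt (G := G) (k := 0) hv hN
        fun s d hd b' _ hmd _ => by
          rw [Nat.zero_add]
          rw [Finset.mem_sdiff] at hd
          exact finish hd.1 (fun _ h => hd.2 (by rwa [h, ← hcw])) hmd
      exact this.mono (by omega)
    · have := finish hc (fun _ => hcw) hm
      rw [Function.update_eq_self] at this
      exact this.succ
  induction n generalizing L L' with
  | zero => exact (colorable hS hL hne hc hm hN).mono (by omega)
  | succ n ih =>
    rcases hS with hS | ⟨x, hx, hS⟩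
    · exact (colorable hS hL hne hc hm hN).mono (by omega)
    by_cases hxv : x = v
    · subst hxv
      obtain ⟨d, hd⟩ := Infinite.exists_notMem_finset (L' x)
      exact (ih (hS d hd) (fun y hy hyx => by simp [hyx, hL y hy hyx]) hne hc hm hN).mono
        (by omega)
    · have hxR : x ∉ R := by simpa using hx
      have hRx : ∀ y ∈ R, ∀ s, Function.update L x s y = L y := fun y hy s =>
        update_apply_of_mem hxR hy L _
      have hvx : ∀ s, Function.update L x s v = L v := fun s =>
        Function.update_of_ne (Ne.symm hxv) _ _
      rw [Nat.add_right_comm]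
      refine Or.inr ⟨x, Finset.mem_univ _, fun d hd => ?_⟩
      rw [hL x hxR hxv] at hd
      refine ih (hS d hd) (fun y hy hyv => ?_) (fun y hy => ?_) ?_ ?_ ?_
      · by_cases hyx : y = x
        · subst hyx; simp [hL y hxR hxv]
        · simp [hyx, hL y hy hyv]
      · rw [hRx y hy]; exact hne y hy
      · rwa [hvx]
      · rwa [monoLists_congr fun y hy => hRx y hy _]
      · rwa [unmetLists_congr (fun y hy => hRx y hy _) (hvx _)]

/-- Requester follows a strategy for the graph without `R` in which `v` has received the
single color `c`. -/
theorem ReqWins.univ_of_singleton (hv : v ∉ R) (hRv : ∀ y ∈ R, ∀ z, G.Adj y z → z = v)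
    (hw : ∀ z, z ∉ R → G.Adj v z → z = w) {n b c : ℕ}
    (hS : ReqWins G (Finset.univ \ R) L' n) (hL : ∀ x ∉ R, x ≠ v → L x = L' x)
    (hL'v : L' v = {c})
    (hne : ∀ y ∈ R, (L y).Nonempty) (hc : c ∈ L v)
    (hm : (monoLists R L c).card ≤ b) (hN : (unmetLists R v L).card < tri (b + 1)) :
    ReqWins G Finset.univ L (n + b) := by
  have colorable : ∀ {L L' : V → Finset ℕ}, ColorableOn G (Finset.univ \ R) L' →
      (∀ x ∉ R, x ≠ v → L x = L' x) → L' v = {c} → (∀ y ∈ R, (L y).Nonempty) → c ∈ L v →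
      (monoLists R L c).card ≤ b → ReqWins G Finset.univ L b := by
    rintro L L' ⟨φ, hφL, hφ⟩ hL hL'v hne hc hm
    have hφv : φ v = c := by simpa [hL'v] using hφL v (by simp [hv])
    refine reqWins_of_card_monoLists_le hv hRv hne (fun x hx => ?_) hφ (by rwa [hφv])
    by_cases hxv : x = v
    · rwa [hxv, hφv]
    · rw [hL x (by simpa using hx) hxv]
      exact hφL x hx
  induction n generalizing L L' with
  | zero => exact (colorable hS hL hL'v hne hc hm).mono (by omega)
  | succ n ih =>
    rcases hS with hS | ⟨x, hx, hS⟩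
    · exact (colorable hS hL hL'v hne hc hm).mono (by omega)
    by_cases hxv : x = v
    · subst hxv
      obtain ⟨d, hd⟩ := Infinite.exists_notMem_finset (L' x)
      exact ((hS d hd).univ_of_surplus hv hRv hw
        (fun y hy hyx => by simp [hyx, hL y hy hyx]) hne hc hm hN).mono (by omega)
    · have hxR : x ∉ R := by simpa using hx
      have hRx : ∀ y ∈ R, ∀ s, Function.update L x s y = L y := fun y hy s =>
        update_apply_of_mem hxR hy L _
      have hvx : ∀ s, Function.update L x s v = L v := fun s =>
        Function.update_of_ne (Ne.symm hxv) _ _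
      rw [Nat.add_right_comm]
      refine Or.inr ⟨x, Finset.mem_univ _, fun d hd => ?_⟩
      rw [hL x hxR hxv] at hd
      refine ih (hS d hd) (fun y hy hyv => ?_) ?_ (fun y hy => ?_) ?_ ?_ ?_
      · by_cases hyx : y = x
        · subst hyx; simp [hL y hxR hxv]
        · simp [hyx, hL y hy hyv]
      · rw [Function.update_of_ne (Ne.symm hxv), hL'v]
      · rw [hRx y hy]; exact hne y hy
      · rwa [hvx]
      · rwa [monoLists_congr fun y hy => hRx y hy _]
      · rwa [unmetLists_congr (fun y hy => hRx y hy _) (hvx _)]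

/-- Requester follows a strategy for the graph without `R` in which `v` has no color yet. -/
theorem ReqWins.univ_of_empty (hv : v ∉ R) (hRv : ∀ y ∈ R, ∀ z, G.Adj y z → z = v)
    (hw : ∀ z, z ∉ R → G.Adj v z → z = w) {n b : ℕ}
    (hS : ReqWins G (Finset.univ \ R) L' n) (hL : ∀ x ∉ R, x ≠ v → L x = L' x)
    (hL'v : L' v = ∅) (hne : ∀ y ∈ R, (L y).Nonempty)
    (hN : (unmetLists R v L).card < tri (b + 1)) :
    ReqWins G Finset.univ L (n + b) := by
  have not_colorable : ∀ {L' : V → Finset ℕ}, L' v = ∅ →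
      ¬ ColorableOn G (Finset.univ \ R) L' := by
    rintro L' hL'v ⟨φ, hφL, -⟩
    simpa [hL'v] using hφL v (by simp [hv])
  induction n generalizing L L' with
  | zero => exact (not_colorable hL'v hS).elim
  | succ n ih =>
    rcases hS with hS | ⟨x, hx, hS⟩
    · exact (not_colorable hL'v hS).elim
    by_cases hxv : x = v
    · subst hxv
      refine reqWins_of_card_unmetLists_lt hv hN fun s c hc b' _ hmc hNs => ?_
      have hR : ∀ y ∈ R, Function.update L x s y = L y := fun y hy =>
        update_apply_of_mem hv hy L _
      refine (hS c (by simp [hL'v])).univ_of_singleton (c := c) hv hRv hw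
        (fun y hy hyx => by simp [hyx, hL y hy hyx]) (by simp [hL'v])
        (fun y hy => ?_) ?_ ?_ hNs
      · rw [hR y hy]; exact hne y hy
      · rw [Function.update_self]; exact (Finset.mem_sdiff.mp hc).1
      · rwa [monoLists_congr hR]
    · have hxR : x ∉ R := by simpa using hx
      have hRx : ∀ y ∈ R, ∀ s, Function.update L x s y = L y := fun y hy s =>
        update_apply_of_mem hxR hy L _
      have hvx : ∀ s, Function.update L x s v = L v := fun s =>
        Function.update_of_ne (Ne.symm hxv) _ _
      rw [Nat.add_right_comm]
      refine Or.inr ⟨x, Finset.mem_univ _, fun d hd => ?_⟩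
      rw [hL x hxR hxv] at hd
      refine ih (hS d hd) (fun y hy hyv => ?_) ?_ (fun y hy => ?_) ?_
      · by_cases hyx : y = x
        · subst hyx; simp [hL y hxR hxv]
        · simp [hyx, hL y hy hyv]
      · rw [Function.update_of_ne (Ne.symm hxv), hL'v]
      · rw [hRx y hy]; exact hne y hy
      · rwa [unmetLists_congr (fun y hy => hRx y hy _) (hvx _)]

theorem reqWins_of_forall_nonempty {n : ℕ} (A : Finset V)
    (hA : ∀ y ∈ R, L y = ∅ → y ∈ A)
    (h : ∀ L₁ : V → Finset ℕ, (∀ y ∈ R, (L₁ y).Nonempty) → (∀ x ∉ A, L₁ x = L x) →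
      ReqWins G Finset.univ L₁ n) :
    ReqWins G Finset.univ L (n + A.card) := by
  induction A using Finset.induction_on generalizing L with
  | empty =>
    refine h L (fun y hy => Finset.nonempty_iff_ne_empty.mpr fun h0 => ?_) fun _ _ => rfl
    simpa using hA y hy h0
  | insert a A ha ih =>
    rw [Finset.card_insert_of_notMem ha, ← Nat.add_assoc]
    refine Or.inr ⟨a, Finset.mem_univ _, fun c _ => ih (fun y hy h0 => ?_) fun L₁ hne hL₁ => ?_⟩
    · by_cases hya : y = a
      · subst hya; simp at h0
      · rw [Function.update_of_ne hya] at h0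
        exact Finset.mem_of_mem_insert_of_ne (hA y hy h0) hya
    · refine h L₁ hne fun x hx => ?_
      rw [Finset.mem_insert, not_or] at hx
      rw [hL₁ x hx.2, Function.update_of_ne hx.1]

end Game

/-- If `v` is a stem with a non-leaf neighbor in a forest `T`, with `r ≥ 1` leaf
neighbors (forming the set `R`), then `χ_ISC(T) ≤ χ_ISC(T - R) + r + u_r`. -/
theorem stmt17 (G : SimpleGraph V) (hG : G.IsAcyclic) (v : V) (R : Finset V)
    (hv : IsStem G v) (hw : ∃ w, G.Adj v w ∧ ¬ IsLeaf G w)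
    (hR : ∀ w, w ∈ R ↔ (G.Adj v w ∧ IsLeaf G w)) (hr : 1 ≤ R.card) :
    isc G Finset.univ ≤ isc G (Finset.univ \ R) + R.card + uval R.card := by
  obtain ⟨w, hvw, hwleaf⟩ := hw
  have hvR : v ∉ R := fun h => G.loopless.irrefl v ((hR v).mp h).1
  have hRv : ∀ y ∈ R, ∀ z, G.Adj y z → z = v := fun y hy z hyz => by
    obtain ⟨hvy, hleaf⟩ := (hR y).mp hy
    obtain ⟨a, ha⟩ := Set.ncard_eq_one.mp hleaf
    have hza : z ∈ G.neighborSet y := hyz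
    have hva : v ∈ G.neighborSet y := hvy.symm
    rw [ha] at hza hva
    exact hza.trans hva.symm
  have hw' : ∀ z, z ∉ R → G.Adj v z → z = w := fun z hz hvz =>
    (Set.ncard_le_one (Set.toFinite _)).mp hv.2 z ⟨hvz, fun h => hz ((hR z).mpr ⟨hvz, h⟩)⟩ w
      ⟨hvw, hwleaf⟩
  have hS : ReqWins G (Finset.univ \ R) (fun _ => ∅) (isc G (Finset.univ \ R)) :=
    Nat.sInf_mem (s := {n | ReqWins G (Finset.univ \ R) (fun _ => ∅) n})
      (exists_reqWins G _ _)
  rw [Nat.add_right_comm]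
  refine Nat.sInf_le (reqWins_of_forall_nonempty R (fun y hy _ => hy) fun L hne hL => ?_)
  exact hS.univ_of_empty hvR hRv hw' (fun x hx _ => hL x hx) rfl hne
    ((Finset.card_filter_le _ _).trans_lt (lt_tri_uval_succ _))
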